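/- Assume c > 0 and a ≥ (c + √(c² + 16))/2. Then the profile (q1*, q2*) = (a/2, a/2) is a Nash equilibrium of the modified Iqbal–Toor quantum Cournot duopoly: u^Q_1(a/2, a/2) ≥ u^Q_1(q1, a/2) and u^Q_2(a/2, a/2) ≥ u^Q_2(a/2, q2) for all q1, q2 ∈ [0,∞). -/

import Mathlib

/-- Player 1's payoff in the modified Iqbal–Toor quantum Cournot duopoly. -/
noncomputable def uQ1 (a c q1 q2 : ℝ) : ℝ :=
  if q1 + q2 ≤ a then q1 * ((a - c) * q1 * q2 - q1 - q2) else -c * q1 * q2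

/-- Player 2's payoff in the modified Iqbal–Toor quantum Cournot duopoly. -/
noncomputable def uQ2 (a c q1 q2 : ℝ) : ℝ :=
  if q1 + q2 ≤ a then q2 * ((a - c) * q1 * q2 - q1 - q2) else -c * q1 * q2

/-- The threshold on `a` amounts to `(a - c) * a ≥ 4`. -/
lemma four_le_sub_mul_of_threshold {a c : ℝ}
    (ha : (c + Real.sqrt (c ^ 2 + 16)) / 2 ≤ a) : 4 ≤ (a - c) * a := by
  have hle : Real.sqrt (c ^ 2 + 16) ≤ 2 * a - c := by linarith
  have hsq : c ^ 2 + 16 ≤ (2 * a - c) ^ 2 := (Real.sqrt_le_left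
    ((Real.sqrt_nonneg _).trans hle)).mp hle
  nlinarith

/-- Against `a / 2`, the response `a / 2` is optimal for player 1. -/
lemma uQ1_half_le {a c : ℝ} (hc : 0 < c) (hca : c < a) (h : 4 ≤ (a - c) * a)
    {q : ℝ} (hq : 0 ≤ q) : uQ1 a c q (a / 2) ≤ uQ1 a c (a / 2) (a / 2) := by
  have ha : 0 < a := hc.trans hca
  have hk : 0 ≤ (a - c) * (a / 2) - 2 := by linarith
  unfold uQ1
  rw [if_pos (add_halves a).le]
  split_ifs with hqa
  · have hfactor : 0 ≤ (a / 2 - q) *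
        (((a - c) * (a / 2) - 2) * (a / 2) + ((a - c) * (a / 2) - 2 + 1) * q) :=
      mul_nonneg (by linarith) (by positivity)
    linear_combination hfactor
  · have hneg : 0 ≤ c * q * (a / 2) := by positivity
    have hpos : 0 ≤ ((a - c) * (a / 2) - 2) * (a / 2) ^ 2 := by positivity
    linear_combination hneg + hpos

/-- The game is symmetric under exchanging the players. -/
lemma uQ2_eq_uQ1_swap (a c q1 q2 : ℝ) : uQ2 a c q1 q2 = uQ1 a c q2 q1 := by
  unfold uQ1 uQ2
  rw [add_comm q1 q2]
  split_ifs <;> ring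

/-- If `c > 0` and `a ≥ (c + √(c² + 16))/2`, then `(a/2, a/2)` is a Nash equilibrium
of the modified Iqbal–Toor quantum Cournot duopoly. -/
theorem iqbal_toor_quantum_equilibrium (a c : ℝ) (hc : 0 < c) (hca : c < a)
    (ha : (c + Real.sqrt (c ^ 2 + 16)) / 2 ≤ a) :
    (∀ q1 : ℝ, 0 ≤ q1 → uQ1 a c q1 (a / 2) ≤ uQ1 a c (a / 2) (a / 2)) ∧
    (∀ q2 : ℝ, 0 ≤ q2 → uQ2 a c (a / 2) q2 ≤ uQ2 a c (a / 2) (a / 2)) := by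
  have h := four_le_sub_mul_of_threshold ha
  refine ⟨fun q1 hq1 => uQ1_half_le hc hca h hq1, fun q2 hq2 => ?_⟩
  rw [uQ2_eq_uQ1_swap, uQ2_eq_uQ1_swap]
  exact uQ1_half_le hc hca h hq2
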